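/- Let D be an open subset of ℝ², let k be a nonzero real number, and let n be a real constant with n ≠ 1. Suppose u : ℝ² → ℂ is eight times continuously differentiable on D and satisfies Δ²(Δ²u − k⁴ n u) = k⁴ (Δ²u − k⁴ n u) on D. Define v := −(1/(k⁴(1 − n)))·(Δ²u − k⁴ n u) and w := −(1/(k⁴(1 − n)))·(Δ²u − k⁴ u). Then on D: (i) w − v = u; (ii) Δ²v = k⁴ v; and (iii) Δ²w = k⁴ n w. -/

import Mathlib

/-- The Laplacian of a function `f : ℝ² → ℂ`, `Δf = ∂²f/∂x₁² + ∂²f/∂x₂²`. -/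
noncomputable def lap (f : EuclideanSpace ℝ (Fin 2) → ℂ)
    (x : EuclideanSpace ℝ (Fin 2)) : ℂ :=
  ∑ i : Fin 2,
    fderiv ℝ (fun y => fderiv ℝ f y (EuclideanSpace.single i 1)) x
      (EuclideanSpace.single i 1)

/-- The biharmonic operator `Δ² = Δ ∘ Δ`. -/
noncomputable def biLap (f : EuclideanSpace ℝ (Fin 2) → ℂ)
    (x : EuclideanSpace ℝ (Fin 2)) : ℂ :=
  lap (lap f) x

open Filter Topology

/-- Taking a directional derivative costs one order of regularity. -/
theorem ContDiffAt.fderiv_apply_const {E F : Type*} [NormedAddCommGroup E] [NormedSpace ℝ E]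
    [NormedAddCommGroup F] [NormedSpace ℝ F] {f : E → F} {x : E} {m n : WithTop ℕ∞}
    (hf : ContDiffAt ℝ n f x) (hmn : m + 1 ≤ n) (e : E) :
    ContDiffAt ℝ m (fun y => fderiv ℝ f y e) x :=
  (hf.fderiv_right hmn).clm_apply contDiffAt_const

theorem fderiv_linear_combination_apply {E : Type*} [NormedAddCommGroup E] [NormedSpace ℝ E]
    {f g : E → ℂ} {x : E} (hf : DifferentiableAt ℝ f x) (hg : DifferentiableAt ℝ g x)
    (a b : ℂ) (e : E) :
    fderiv ℝ (fun y => a * f y + b * g y) x e = a * fderiv ℝ f x e + b * fderiv ℝ g x e := by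
  rw [fderiv_fun_add (hf.const_mul a) (hg.const_mul b), fderiv_const_mul hf, fderiv_const_mul hg]
  simp

theorem ContDiffAt.lap {f : EuclideanSpace ℝ (Fin 2) → ℂ} {x : EuclideanSpace ℝ (Fin 2)}
    {m n : WithTop ℕ∞} (hf : ContDiffAt ℝ n f x) (hmn : m + 1 + 1 ≤ n) :
    ContDiffAt ℝ m (lap f) x :=
  ContDiffAt.sum fun i _ =>
    (hf.fderiv_apply_const hmn (EuclideanSpace.single i 1)).fderiv_apply_const le_rfl _

theorem lap_linear_combination {f g : EuclideanSpace ℝ (Fin 2) → ℂ}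
    {x : EuclideanSpace ℝ (Fin 2)} (hf : ContDiffAt ℝ 2 f x) (hg : ContDiffAt ℝ 2 g x)
    (a b : ℂ) : lap (fun y => a * f y + b * g y) x = a * lap f x + b * lap g x := by
  simp only [lap, Finset.mul_sum, ← Finset.sum_add_distrib]
  refine Finset.sum_congr rfl fun i _ => ?_
  have hfirst : (fun y => fderiv ℝ (fun z => a * f z + b * g z) y (EuclideanSpace.single i 1))
      =ᶠ[𝓝 x] fun y => a * fderiv ℝ f y (EuclideanSpace.single i 1) +
        b * fderiv ℝ g y (EuclideanSpace.single i 1) := by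
    filter_upwards [hf.eventually (by simp), hg.eventually (by simp)] with y hfy hgy
    exact fderiv_linear_combination_apply (hfy.differentiableAt (by simp))
      (hgy.differentiableAt (by simp)) a b _
  have one_add_one_le : (1 : WithTop ℕ∞) + 1 ≤ 2 := by norm_num
  rw [hfirst.fderiv_eq]
  exact fderiv_linear_combination_apply
    ((hf.fderiv_apply_const one_add_one_le _).differentiableAt (by simp))
    ((hg.fderiv_apply_const one_add_one_le _).differentiableAt (by simp)) a b _

theorem lap_congr_nhds {f g : EuclideanSpace ℝ (Fin 2) → ℂ} {x : EuclideanSpace ℝ (Fin 2)}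
    (h : f =ᶠ[𝓝 x] g) : lap f x = lap g x := by
  refine Finset.sum_congr rfl fun i _ => ?_
  have hfirst : (fun y => fderiv ℝ f y (EuclideanSpace.single i 1))
      =ᶠ[𝓝 x] fun y => fderiv ℝ g y (EuclideanSpace.single i 1) := by
    filter_upwards [h.fderiv (𝕜 := ℝ)] with y hy
    rw [hy]
  rw [hfirst.fderiv_eq]

theorem biLap_linear_combination {f g : EuclideanSpace ℝ (Fin 2) → ℂ}
    {x : EuclideanSpace ℝ (Fin 2)} (hf : ContDiffAt ℝ 4 f x) (hg : ContDiffAt ℝ 4 g x)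
    (a b : ℂ) : biLap (fun y => a * f y + b * g y) x = a * biLap f x + b * biLap g x := by
  have two_le : (2 : WithTop ℕ∞) ≤ 4 := by norm_num
  have two_add_two_le : (2 : WithTop ℕ∞) + 1 + 1 ≤ 4 := by norm_num
  have hinner : lap (fun y => a * f y + b * g y) =ᶠ[𝓝 x] fun y => a * lap f y + b * lap g y := by
    filter_upwards [hf.eventually (by simp), hg.eventually (by simp)] with y hfy hgy
    exact lap_linear_combination (hfy.of_le two_le) (hgy.of_le two_le) a b
  rw [biLap, lap_congr_nhds hinner]
  exact lap_linear_combination (hf.lap two_add_two_le) (hg.lap two_add_two_le) a b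

/-- Reconstruction of the transmission eigenfunctions from a solution `u` of the
fourth-order formulation `Δ²(Δ²u − k⁴ n u) = k⁴(Δ²u − k⁴ n u)` on an open set
`D ⊆ ℝ²`: with `v = −(Δ²u − k⁴ n u)/(k⁴(1 − n))` and `w = −(Δ²u − k⁴ u)/(k⁴(1 − n))`
one has `w − v = u`, `Δ²v = k⁴ v` and `Δ²w = k⁴ n w` on `D`. -/
theorem fourth_order_to_transmission_system
    (D : Set (EuclideanSpace ℝ (Fin 2))) (hD : IsOpen D)
    (k : ℝ) (hk : k ≠ 0) (n : ℝ) (hn : n ≠ 1)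
    (u : EuclideanSpace ℝ (Fin 2) → ℂ)
    (hu : ContDiffOn ℝ 8 u D)
    (heq : ∀ x ∈ D,
      biLap (fun y => biLap u y - (k : ℂ) ^ 4 * (n : ℂ) * u y) x
        = (k : ℂ) ^ 4 * (biLap u x - (k : ℂ) ^ 4 * (n : ℂ) * u x))
    (v w : EuclideanSpace ℝ (Fin 2) → ℂ)
    (hv : v = fun x => -(1 / ((k : ℂ) ^ 4 * (1 - (n : ℂ)))) *
      (biLap u x - (k : ℂ) ^ 4 * (n : ℂ) * u x))
    (hw : w = fun x => -(1 / ((k : ℂ) ^ 4 * (1 - (n : ℂ)))) *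
      (biLap u x - (k : ℂ) ^ 4 * u x)) :
    (∀ x ∈ D, w x - v x = u x) ∧
    (∀ x ∈ D, biLap v x = (k : ℂ) ^ 4 * v x) ∧
    (∀ x ∈ D, biLap w x = (k : ℂ) ^ 4 * (n : ℂ) * w x) := by
  have hk' : (k : ℂ) ≠ 0 := by exact_mod_cast hk
  have hn' : (1 : ℂ) - n ≠ 0 := sub_ne_zero.mpr (by exact_mod_cast hn.symm)
  have hwv : ∀ x, w x = v x + u x := by
    intro x
    simp only [hv, hw]
    field_simp
    ring
  have hbiLap : ∀ x, biLap u x = (k : ℂ) ^ 4 * n * u x - (k : ℂ) ^ 4 * (1 - n) * v x := by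
    intro x
    simp only [hv]
    field_simp
    ring
  have hu8 : ∀ x ∈ D, ContDiffAt ℝ 8 u x := fun x hx => hu.contDiffAt (hD.mem_nhds hx)
  have hu4 : ∀ x ∈ D, ContDiffAt ℝ 4 u x := fun x hx => (hu8 x hx).of_le (by norm_num)
  have hf4 : ∀ x ∈ D,
      ContDiffAt ℝ 4 (fun y => biLap u y - (k : ℂ) ^ 4 * (n : ℂ) * u y) x := by
    intro x hx
    have hlap : ContDiffAt ℝ 6 (lap u) x := (hu8 x hx).lap (by norm_num)
    have hbi : ContDiffAt ℝ 4 (biLap u) x := hlap.lap (by norm_num)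
    exact hbi.sub (contDiffAt_const.mul (hu4 x hx))
  have hv4 : ∀ x ∈ D, ContDiffAt ℝ 4 v x := by
    intro x hx
    rw [hv]
    exact contDiffAt_const.mul (hf4 x hx)
  have hv_eq : ∀ x ∈ D, biLap v x = (k : ℂ) ^ 4 * v x := by
    intro x hx
    have h := biLap_linear_combination (hf4 x hx) (hf4 x hx)
      (-(1 / ((k : ℂ) ^ 4 * (1 - (n : ℂ))))) 0
    simp only [zero_mul, add_zero] at h
    rw [hv, h, heq x hx]
    ring
  refine ⟨fun x _ => by rw [hwv x]; ring, hv_eq, fun x hx => ?_⟩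
  have hw_sum : w = fun y => 1 * v y + 1 * u y := by
    funext y
    rw [hwv y, one_mul, one_mul]
  have h := biLap_linear_combination (hv4 x hx) (hu4 x hx) 1 1
  rw [← hw_sum, hv_eq x hx, hbiLap x] at h
  rw [h, hwv x]
  ring
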